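/- arXiv:1908.00127 — 3 statements merged into one kernel-verified Lean document; each statement's English description precedes it below -/
import Mathlib

section
/- Let G be a connected, locally finite, vertex-transitive simple graph with distinguished vertex o such that μ_p < μ_w. Then there exist real numbers ε > 0 and c > 0 such that for every n ≥ 1, the number of self-avoiding walks w of length n starting at o whose endpoint w(n) satisfies d_G(o, w(n)) < εn is at most e^{-cn} · c_n. (Equivalently, under the uniform measure on n-step self-avoiding walks from o, the probability that d_G(o, w(n)) ≥ εn is at least 1 − e^{-cn}.) -/
open Filter

theorem limsup_rpow_one_div_le {f : ℕ → ℝ} {C a : ℝ} (ha : 0 ≤ a) (hf : ∀ n, 0 ≤ f n)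
    (h : ∀ᶠ n in atTop, f n ≤ C * a ^ n) :
    limsup (fun n : ℕ => f n ^ (1 / (n : ℝ))) atTop ≤ a := by
  have hlim : Tendsto (fun n : ℕ => max C 1 ^ (1 / (n : ℝ)) * a) atTop (nhds a) := by
    have h1 : Tendsto (fun n : ℕ => max C 1 ^ (1 / (n : ℝ))) atTop (nhds (max C 1 ^ (0 : ℝ))) :=
      tendsto_const_nhds.rpow tendsto_one_div_atTop_nhds_zero_nat
        (Or.inl (by positivity))
    simpa using h1.mul_const a
  rw [← hlim.limsup_eq]
  refine limsup_le_limsup ?_ ?_ hlim.isBoundedUnder_le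
  · filter_upwards [h, eventually_ge_atTop 1] with n hn hn1
    calc f n ^ (1 / (n : ℝ)) ≤ (max C 1 * a ^ n) ^ (1 / (n : ℝ)) := by
          refine Real.rpow_le_rpow (hf n) (hn.trans ?_) (by positivity)
          exact mul_le_mul_of_nonneg_right (le_max_left _ _) (by positivity)
      _ = max C 1 ^ (1 / (n : ℝ)) * a := by
          rw [Real.mul_rpow (by positivity) (by positivity), one_div,
            Real.pow_rpow_inv_natCast ha (by omega)]
  · exact IsBoundedUnder.isCoboundedUnder_le
      (isBoundedUnder_of ⟨0, fun n => Real.rpow_nonneg (hf n) _⟩)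

/-- The growth rate of a submultiplicative sequence is a lower bound for its normalized terms. -/
theorem pow_limsup_le_of_submultiplicative {c : ℕ → ℕ} (hc : ∀ m n, c (m + n) ≤ c m * c n)
    {m : ℕ} (hm : 1 ≤ m) (h0 : 0 ≤ limsup (fun n : ℕ => (c n : ℝ) ^ (1 / (n : ℝ))) atTop) :
    limsup (fun n : ℕ => (c n : ℝ) ^ (1 / (n : ℝ))) atTop ^ m ≤ c m := by
  set a : ℝ := (c m : ℝ) ^ (1 / (m : ℝ)) with ha
  have ha0 : 0 ≤ a := by positivity
  have ham : a ^ m = c m := by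
    rw [ha, one_div, Real.rpow_inv_natCast_pow (by positivity) (by omega)]
  rw [← ham]
  refine pow_le_pow_left₀ h0 ?_ m
  have hq : ∀ q s, c (m * q + s) ≤ c m ^ q * c s := by
    intro q s
    induction q with
    | zero => simp
    | succ q ih =>
      calc c (m * (q + 1) + s) = c (m + (m * q + s)) := by ring_nf
        _ ≤ c m * (c m ^ q * c s) := (hc _ _).trans (Nat.mul_le_mul_left _ ih)
        _ = c m ^ (q + 1) * c s := by ring
  refine limsup_rpow_one_div_le (C := ∑ s ∈ Finset.range m, (c s : ℝ)) ha0
    (fun n => Nat.cast_nonneg _) ?_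
  filter_upwards [eventually_ge_atTop m] with n hn
  have hmod : n % m < m := Nat.mod_lt _ hm
  have hC : (c (n % m) : ℝ) ≤ ∑ s ∈ Finset.range m, (c s : ℝ) :=
    Finset.single_le_sum (f := fun s => (c s : ℝ)) (fun s _ => Nat.cast_nonneg _)
      (Finset.mem_range.mpr hmod)
  have h1 : (c n : ℝ) ≤ (c m : ℝ) ^ (n / m) * c (n % m) := by
    have := hq (n / m) (n % m)
    rw [Nat.div_add_mod] at this
    exact_mod_cast this
  have h2 : (c m : ℝ) ^ (n / m) ≤ a ^ n := by
    rcases Nat.eq_zero_or_pos (c m) with h | h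
    · rw [h, Nat.cast_zero, zero_pow (Nat.div_pos hn hm).ne']
      positivity
    · have h1a : 1 ≤ a := Real.one_le_rpow (by exact_mod_cast h) (by positivity)
      rw [← ham, ← pow_mul]
      exact pow_le_pow_right₀ h1a (Nat.mul_div_le n m)
  calc (c n : ℝ) ≤ (c m : ℝ) ^ (n / m) * c (n % m) := h1
    _ ≤ a ^ n * ∑ s ∈ Finset.range m, (c s : ℝ) := by gcongr
    _ = _ := mul_comm _ _

theorem isBoundedUnder_rpow_one_div {p : ℕ → ℕ} {Δ : ℕ} (hp : ∀ n, p n ≤ Δ ^ n) :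
    IsBoundedUnder (· ≤ ·) atTop fun n : ℕ => (p n : ℝ) ^ (1 / (n : ℝ)) := by
  refine isBoundedUnder_of_eventually_le (a := (Δ : ℝ)) ?_
  filter_upwards [eventually_ge_atTop 1] with n hn
  calc (p n : ℝ) ^ (1 / (n : ℝ)) ≤ ((Δ : ℝ) ^ n) ^ (1 / (n : ℝ)) :=
        Real.rpow_le_rpow (by positivity) (by exact_mod_cast hp n) (by positivity)
    _ = Δ := by rw [one_div, Real.pow_rpow_inv_natCast (by positivity) (by omega)]

/-- A power series converges inside its radius of convergence. -/
theorem tsum_mul_ofReal_pow_ne_top {p : ℕ → ℕ} {Δ : ℕ} (hp : ∀ n, p n ≤ Δ ^ n) {x : ℝ}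
    (hx : 0 < x) (h : limsup (fun n : ℕ => (p n : ℝ) ^ (1 / (n : ℝ))) atTop < x) :
    ∑' n : ℕ, (p n : ENNReal) * ENNReal.ofReal x⁻¹ ^ n ≠ ⊤ := by
  have hbdd := isBoundedUnder_rpow_one_div hp
  obtain ⟨y, hly, hyx⟩ := exists_between (max_lt h hx)
  have hy : 0 < y := (le_max_right _ _).trans_lt hly
  have hev := eventually_lt_of_limsup_lt ((le_max_left _ _).trans_lt hly) hbdd
  have hsum : Summable fun n : ℕ => (p n : ℝ) * x⁻¹ ^ n := by
    refine Summable.of_norm_bounded_eventually_nat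
      (g := fun n => (y / x) ^ n)
      (summable_geometric_of_lt_one (by positivity) ((div_lt_one hx).mpr hyx)) ?_
    filter_upwards [hev, eventually_ge_atTop 1] with n hn hn1
    rw [Real.norm_of_nonneg (by positivity), div_eq_mul_inv, mul_pow]
    refine mul_le_mul_of_nonneg_right ?_ (by positivity)
    rw [← Real.rpow_inv_natCast_pow (Nat.cast_nonneg (p n)) (by omega : n ≠ 0), ← one_div]
    exact pow_le_pow_left₀ (by positivity) hn.le n
  convert hsum.tsum_ofReal_ne_top using 4 with n
  rw [ENNReal.ofReal_mul (by positivity), ENNReal.ofReal_natCast,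
    ENNReal.ofReal_pow (by positivity)]

namespace SimpleGraph

open scoped Classical ENNReal symmDiff

variable {V : Type*} {G : SimpleGraph V}

/-- The coboundary modulo `2` of a vertex function, evaluated at an edge. -/
def coboundary (g : V → ZMod 2) : Sym2 V → ZMod 2 :=
  Sym2.lift ⟨fun x y => g x + g y, fun x y => add_comm (g x) (g y)⟩

@[simp]
theorem coboundary_mk (g : V → ZMod 2) (x y : V) : coboundary g s(x, y) = g x + g y := rfl

/-- A finite edge set is even if it is orthogonal to every coboundary modulo `2`, i.e. if every
vertex is incident with an even number of its edges. -/
def IsEvenEdgeSet (F : Finset (Sym2 V)) : Prop :=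
  ∀ g : V → ZMod 2, ∑ e ∈ F, coboundary g e = 0

theorem sum_symmDiff_zmod_two {α : Type*} [DecidableEq α] (f : α → ZMod 2) (A B : Finset α) :
    ∑ e ∈ A ∆ B, f e = ∑ e ∈ A, f e + ∑ e ∈ B, f e := by
  have h1 : A ∆ B = (A \ B) ∪ (B \ A) := rfl
  rw [h1, Finset.sum_union (by
    rw [Finset.disjoint_left]; intro x hx; simp only [Finset.mem_sdiff] at *; tauto),
    ← Finset.sum_inter_add_sum_sdiff A B f, ← Finset.sum_inter_add_sum_sdiff B A f,
    Finset.inter_comm B A]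
  linear_combination - CharTwo.add_self_eq_zero (∑ e ∈ A ∩ B, f e)

theorem sum_coboundary_edges {u v : V} (p : G.Walk u v) (g : V → ZMod 2) :
    (p.edges.map (coboundary g)).sum = g u + g v := by
  induction p with
  | nil => simp [CharTwo.add_self_eq_zero]
  | @cons a b c h p ih =>
    simp only [Walk.edges_cons, List.map_cons, List.sum_cons, ih, coboundary_mk]
    linear_combination CharTwo.add_self_eq_zero (g b)

theorem Walk.IsTrail.sum_coboundary {u v : V} {p : G.Walk u v} (hp : p.IsTrail)
    (g : V → ZMod 2) : ∑ e ∈ p.edges.toFinset, coboundary g e = g u + g v := by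
  rw [List.sum_toFinset _ hp.edges_nodup, sum_coboundary_edges]

theorem Walk.IsTrail.card_edges_toFinset {u v : V} {p : G.Walk u v} (hp : p.IsTrail) :
    p.edges.toFinset.card = p.length := by
  rw [List.toFinset_card_of_nodup hp.edges_nodup, Walk.length_edges]

theorem Walk.IsTrail.isEvenEdgeSet {u : V} {p : G.Walk u u} (hp : p.IsTrail) :
    IsEvenEdgeSet p.edges.toFinset := fun g => by
  rw [hp.sum_coboundary, CharTwo.add_self_eq_zero]

theorem Walk.IsTrail.isEvenEdgeSet_symmDiff {u v : V} {p q : G.Walk u v} (hp : p.IsTrail)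
    (hq : q.IsTrail) : IsEvenEdgeSet (p.edges.toFinset ∆ q.edges.toFinset) := fun g => by
  rw [sum_symmDiff_zmod_two, hp.sum_coboundary, hq.sum_coboundary, CharTwo.add_self_eq_zero]

theorem IsEvenEdgeSet.sdiff {A B : Finset (Sym2 V)} (hA : IsEvenEdgeSet A) (hB : IsEvenEdgeSet B)
    (h : B ⊆ A) : IsEvenEdgeSet (A \ B) := fun g => by
  have := Finset.sum_sdiff (f := coboundary g) h
  rwa [hA g, hB g, add_zero] at this

/-- The edge set of a path contains no nonempty even subset. -/
theorem Walk.IsPath.eq_empty_of_isEvenEdgeSet {u v : V} {p : G.Walk u v} (hp : p.IsPath)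
    {F : Finset (Sym2 V)} (hF : IsEvenEdgeSet F) (hsub : ∀ e ∈ F, e ∈ p.edges) : F = ∅ := by
  induction p with
  | nil => exact Finset.eq_empty_of_forall_notMem fun e he => by simpa using hsub e he
  | @cons a b c h p ih =>
    rw [Walk.cons_isPath_iff] at hp
    refine ih hp.1 fun e he => ?_
    have hmem := hsub e he
    rw [Walk.edges_cons, List.mem_cons] at hmem
    refine hmem.resolve_left fun heq => ?_
    subst heq
    have h0 := hF (Pi.single a 1)
    rw [Finset.sum_eq_single_of_mem _ he] at h0
    · simp [h.ne'] at h0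
    · intro f hf hne
      have hfp : f ∈ p.edges := by
        have := hsub f hf
        rw [Walk.edges_cons, List.mem_cons] at this
        exact this.resolve_left hne
      induction f with
      | _ x y =>
        have hx : x ≠ a := fun hx => hp.2 (hx ▸ p.fst_mem_support_of_mem_edges hfp)
        have hy : y ≠ a := fun hy => hp.2 (hy ▸ p.snd_mem_support_of_mem_edges hfp)
        simp [hx, hy]

/-- Every edge of an even edge set lies on a cycle contained in it. -/
theorem IsEvenEdgeSet.exists_isCycle {F : Finset (Sym2 V)} (hF : IsEvenEdgeSet F)
    (hG : (F : Set (Sym2 V)) ⊆ G.edgeSet) {a b : V} (hab : s(a, b) ∈ F) :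
    ∃ w : G.Walk a a, w.IsCycle ∧ s(a, b) ∈ w.edges ∧ w.edges.toFinset ⊆ F := by
  have hadj : G.Adj a b := hG hab
  let H : SimpleGraph V := fromEdgeSet ((F.erase s(a, b) : Finset (Sym2 V)) : Set (Sym2 V))
  have hHe : ∀ e ∈ H.edgeSet, e ∈ F.erase s(a, b) := fun e he => by
    simp only [H, edgeSet_fromEdgeSet] at he
    exact he.1
  have hreach : H.Reachable b a := by
    by_contra hcon
    have h0 := hF fun x => if H.Reachable b x then 1 else 0
    rw [← Finset.add_sum_erase _ _ hab, Finset.sum_eq_zero, coboundary_mk] at h0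
    · simp [hcon] at h0
    · intro f hf
      induction f with
      | _ x y =>
        have hne : x ≠ y := (show G.Adj x y from hG (Finset.mem_of_mem_erase hf)).ne
        have hxy : H.Adj x y := by
          simp only [H, fromEdgeSet_adj]
          exact ⟨hf, hne⟩
        have hiff : H.Reachable b x ↔ H.Reachable b y :=
          ⟨fun h => h.trans hxy.reachable, fun h => h.trans hxy.symm.reachable⟩
        simp only [coboundary_mk, hiff, CharTwo.add_self_eq_zero]
  obtain ⟨p, hp⟩ := hreach.exists_isPath
  have hpe : ∀ e ∈ p.edges, e ∈ F.erase s(a, b) := fun e he => hHe e (p.edges_subset_edgeSet he)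
  have hpG : ∀ e ∈ p.edges, e ∈ G.edgeSet := fun e he => hG (Finset.mem_of_mem_erase (hpe e he))
  refine ⟨Walk.cons hadj (p.transfer G hpG), ?_, by simp, ?_⟩
  · rw [Walk.cons_isCycle_iff]
    refine ⟨hp.transfer hpG, fun h => ?_⟩
    rw [Walk.edges_transfer] at h
    exact Finset.notMem_erase _ _ (hpe _ h)
  · intro e he
    rw [List.mem_toFinset, Walk.edges_cons, Walk.edges_transfer, List.mem_cons] at he
    rcases he with rfl | he
    · exact hab
    · exact Finset.mem_of_mem_erase (hpe e he)

/-- The even edge sets of `G` all of whose nonempty even subsets meet the list `L`. -/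
def evenEdgeSetsMeeting (G : SimpleGraph V) (L : List (Sym2 V)) : Set (Finset (Sym2 V)) :=
  {F | (F : Set (Sym2 V)) ⊆ G.edgeSet ∧ IsEvenEdgeSet F ∧
    ∀ F' ⊆ F, IsEvenEdgeSet F' → F'.Nonempty → ∃ e ∈ L, e ∈ F'}

theorem evenEdgeSetsMeeting_nil : evenEdgeSetsMeeting G [] ⊆ {∅} := by
  rintro F ⟨-, hF, h⟩
  by_contra hne
  obtain ⟨e, he, -⟩ := h F subset_rfl hF (Finset.nonempty_iff_ne_empty.mpr hne)
  simp at he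

/-- Deleting a cycle through `s(a, b)`. -/
theorem exists_cycle_sdiff_mem_evenEdgeSetsMeeting {L : List (Sym2 V)} {a b : V}
    {F : Finset (Sym2 V)} (hF : F ∈ evenEdgeSetsMeeting G (s(a, b) :: L)) (hab : s(a, b) ∈ F) :
    ∃ w : G.Walk a a, w.IsCycle ∧ w.edges.toFinset ⊆ F ∧
      F \ w.edges.toFinset ∈ evenEdgeSetsMeeting G L := by
  obtain ⟨w, hw, hmem, hsub⟩ := hF.2.1.exists_isCycle hF.1 hab
  refine ⟨w, hw, hsub, fun e he => hF.1 ?_, hF.2.1.sdiff hw.isCircuit.isTrail.isEvenEdgeSet hsub, ?_⟩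
  · exact (Finset.sdiff_subset he : e ∈ F)
  · intro F' hF' hev hne
    obtain ⟨e, he, heF⟩ := hF.2.2 F' (hF'.trans Finset.sdiff_subset) hev hne
    rcases List.mem_cons.mp he with rfl | he
    · exact absurd (List.mem_toFinset.mpr hmem) (Finset.mem_sdiff.mp (hF' heF)).2
    · exact ⟨e, he, heF⟩

theorem mem_evenEdgeSetsMeeting_of_notMem {L : List (Sym2 V)} {e : Sym2 V}
    {F : Finset (Sym2 V)} (hF : F ∈ evenEdgeSetsMeeting G (e :: L)) (he : e ∉ F) :
    F ∈ evenEdgeSetsMeeting G L := by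
  refine ⟨hF.1, hF.2.1, fun F' hF' hev hne => ?_⟩
  obtain ⟨f, hf, hfF⟩ := hF.2.2 F' hF' hev hne
  rcases List.mem_cons.mp hf with rfl | hf
  · exact absurd (hF' hfF) he
  · exact ⟨f, hf, hfF⟩

/-- The generating function of even edge sets meeting `L` is at most exponential in the length
of `L`, with base controlled by the generating function of cycles. -/
theorem tsum_evenEdgeSetsMeeting_le {z P : ℝ≥0∞}
    (hP : ∀ v, ∑' C : {w : G.Walk v v // w.IsCycle}, z ^ C.1.length ≤ P) (L : List (Sym2 V)) :
    ∑' F : evenEdgeSetsMeeting G L, z ^ F.1.card ≤ (1 + P) ^ L.length := by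
  induction L with
  | nil =>
    refine (ENNReal.tsum_mono_subtype (fun F : Finset (Sym2 V) => z ^ F.card)
      evenEdgeSetsMeeting_nil).trans ?_
    simp
  | cons e L ih =>
    induction e with
    | _ a b =>
    set S := evenEdgeSetsMeeting G L
    set T := {F ∈ evenEdgeSetsMeeting G (s(a, b) :: L) | s(a, b) ∈ F}
    have hsub : evenEdgeSetsMeeting G (s(a, b) :: L) ⊆ S ∪ T := fun F hF => by
      by_cases h : s(a, b) ∈ F
      · exact Or.inr ⟨hF, h⟩
      · exact Or.inl (mem_evenEdgeSetsMeeting_of_notMem hF h)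
    have hT : ∑' F : T, z ^ F.1.card ≤ P * (1 + P) ^ L.length := by
      have hex := fun F : T => exists_cycle_sdiff_mem_evenEdgeSetsMeeting F.2.1 F.2.2
      choose w hw hwF hwS using hex
      let f : T → {w : G.Walk a a // w.IsCycle} × S := fun F => (⟨w F, hw F⟩, ⟨_, hwS F⟩)
      have hf : Function.Injective f := fun F F' h => by
        simp only [f, Prod.mk.injEq, Subtype.mk.injEq] at h
        apply Subtype.ext
        rw [← Finset.sdiff_union_of_subset (hwF F), ← Finset.sdiff_union_of_subset (hwF F'),
          h.2, h.1]
      calc ∑' F : T, z ^ F.1.card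
          = ∑' F : T, z ^ (f F).1.1.length * z ^ (f F).2.1.card := by
            refine tsum_congr fun F => ?_
            rw [← pow_add, ← (hw F).isCircuit.isTrail.card_edges_toFinset, add_comm,
              Finset.card_sdiff_add_card_eq_card (hwF F)]
        _ ≤ ∑' q : {w : G.Walk a a // w.IsCycle} × S, z ^ q.1.1.length * z ^ q.2.1.card :=
            ENNReal.tsum_comp_le_tsum_of_injective hf _
        _ = (∑' C : {w : G.Walk a a // w.IsCycle}, z ^ C.1.length) * ∑' F : S, z ^ F.1.card := by
            rw [ENNReal.tsum_prod']
            simp only [ENNReal.tsum_mul_left, ENNReal.tsum_mul_right]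
        _ ≤ P * (1 + P) ^ L.length := mul_le_mul' (hP a) ih
    calc ∑' F : evenEdgeSetsMeeting G (s(a, b) :: L), z ^ F.1.card
        ≤ ∑' F : ↑(S ∪ T), z ^ F.1.card :=
          ENNReal.tsum_mono_subtype (fun F : Finset (Sym2 V) => z ^ F.card) hsub
      _ ≤ ∑' F : S, z ^ F.1.card + ∑' F : T, z ^ F.1.card :=
          ENNReal.tsum_union_le (fun F : Finset (Sym2 V) => z ^ F.card) S T
      _ ≤ (1 + P) ^ L.length + P * (1 + P) ^ L.length := add_le_add ih hT
      _ = (1 + P) ^ (s(a, b) :: L).length := by rw [List.length_cons, pow_succ]; ring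

/-- A path is determined by its end vertices and its edge set. -/
theorem Walk.IsPath.eq_of_edges_toFinset_eq {u v : V} {p q : G.Walk u v} (hp : p.IsPath)
    (hq : q.IsPath) (h : p.edges.toFinset = q.edges.toFinset) : p = q := by
  induction p with
  | nil => exact (Walk.isPath_iff_nil.mp hq).eq_nil.symm
  | @cons a b c hab p ih =>
    cases q with
    | nil => simp at h
    | @cons _ b' _ hab' q =>
      have hp' := (Walk.cons_isPath_iff _ _).mp hp
      have hq' := (Walk.cons_isPath_iff _ _).mp hq
      have hnp : ∀ y, s(a, y) ∉ p.edges := fun y hy => hp'.2 (p.fst_mem_support_of_mem_edges hy)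
      have hnq : ∀ y, s(a, y) ∉ q.edges := fun y hy => hq'.2 (q.fst_mem_support_of_mem_edges hy)
      simp only [Walk.edges_cons, List.toFinset_cons] at h
      have hb : b = b' := by
        have h1 : s(a, b) ∈ insert s(a, b') q.edges.toFinset := h ▸ Finset.mem_insert_self _ _
        rw [Finset.mem_insert, List.mem_toFinset] at h1
        exact Sym2.congr_right.mp (h1.resolve_right (hnq b))
      subst hb
      rw [ih hp'.1 hq'.1]
      have := congrArg (fun s => s.erase s(a, b)) h
      simpa [Finset.erase_insert, hnp, hnq] using this

theorem Walk.IsPath.symmDiff_mem_evenEdgeSetsMeeting {u v : V} {p q : G.Walk u v} (hp : p.IsPath)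
    (hq : q.IsPath) :
    p.edges.toFinset ∆ q.edges.toFinset ∈ evenEdgeSetsMeeting G q.edges := by
  refine ⟨fun e he => ?_, hp.isTrail.isEvenEdgeSet_symmDiff hq.isTrail, fun F hF hev hne => ?_⟩
  · rw [Finset.mem_coe, Finset.mem_symmDiff, List.mem_toFinset, List.mem_toFinset] at he
    rcases he with he | he
    · exact p.edges_subset_edgeSet he.1
    · exact q.edges_subset_edgeSet he.1
  · by_contra! hcon
    refine hne.ne_empty (hp.eq_empty_of_isEvenEdgeSet hev fun e he => ?_)
    have h1 := hF he
    rw [Finset.mem_symmDiff, List.mem_toFinset, List.mem_toFinset] at h1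
    rcases h1 with h1 | h1
    · exact h1.1
    · exact absurd he (hcon e h1.1)

/-- The number of paths of length `n` between two vertices at distance `d`, weighted by `z ^ n`,
is at most exponential in `d`. Here `m ≤ 1` is a common lower bound for `z` and `z⁻¹`. -/
theorem tsum_isPath_le {z m P : ℝ≥0∞} (hz0 : z ≠ 0) (hzt : z ≠ ⊤) (hm1 : m ≤ 1) (hmz : m ≤ z)
    (hmz' : m ≤ z⁻¹) (hP : ∀ v, ∑' C : {w : G.Walk v v // w.IsCycle}, z ^ C.1.length ≤ P)
    {u v : V} {q : G.Walk u v} (hq : q.IsPath) (n : ℕ) :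
    ∑' _ : {p : G.Walk u v // p.IsPath ∧ p.length = n}, m ^ q.length * z ^ n
      ≤ (1 + P) ^ q.length := by
  have hP' := tsum_evenEdgeSetsMeeting_le hP q.edges
  rw [Walk.length_edges] at hP'
  refine le_trans ?_ hP'
  let f : {p : G.Walk u v // p.IsPath ∧ p.length = n} → evenEdgeSetsMeeting G q.edges :=
    fun p => ⟨_, p.2.1.symmDiff_mem_evenEdgeSetsMeeting hq⟩
  have hf : Function.Injective f := fun p p' h => Subtype.ext <|
    p.2.1.eq_of_edges_toFinset_eq p'.2.1 (symmDiff_left_injective _ (congrArg Subtype.val h))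
  refine le_trans (ENNReal.tsum_le_tsum fun p => ?_)
    (ENNReal.tsum_comp_le_tsum_of_injective hf fun F => z ^ F.1.card)
  have hp := p.2.1.isTrail.card_edges_toFinset
  have hqc := hq.isTrail.card_edges_toFinset
  rw [p.2.2] at hp
  have hle : (f p).1.card ≤ n + q.length := by
    rw [← hp, ← hqc]
    exact (Finset.card_le_card symmDiff_le_sup).trans (Finset.card_union_le _ _)
  have hge : n ≤ (f p).1.card + q.length := by
    rw [← hp, ← hqc]
    refine (Finset.card_le_card fun e he => ?_).trans (Finset.card_union_le _ _)
    by_cases h : e ∈ q.edges.toFinset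
    · exact Finset.mem_union_right _ h
    · exact Finset.mem_union_left _ (Finset.mem_symmDiff.mpr (Or.inl ⟨he, h⟩))
  set k := (f p).1.card
  rcases le_total n k with h | h
  · obtain ⟨j, hj⟩ := Nat.exists_eq_add_of_le h
    rw [hj, pow_add, mul_comm]
    refine mul_le_mul_right ?_ _
    exact (pow_le_pow_right_of_le_one' hm1 (by omega : j ≤ q.length)).trans (pow_le_pow_left' hmz j)
  · obtain ⟨j, hj⟩ := Nat.exists_eq_add_of_le h
    rw [hj, pow_add]
    calc m ^ q.length * (z ^ k * z ^ j) ≤ z⁻¹ ^ j * (z ^ k * z ^ j) := by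
          refine mul_le_mul_left ?_ _
          exact (pow_le_pow_right_of_le_one' hm1 (by omega : j ≤ q.length)).trans (pow_le_pow_left' hmz' j)
      _ = z ^ k * (z⁻¹ * z) ^ j := by rw [mul_pow]; ring
      _ = z ^ k := by rw [ENNReal.inv_mul_cancel hz0 hzt, one_pow, mul_one]

section Counting

variable [G.LocallyFinite]

theorem exists_finset_walk_length_eq {Δ : ℕ} (hΔ : ∀ v, G.degree v ≤ Δ) (n : ℕ) (u : V) :
    ∃ T : Finset (Σ v, G.Walk u v), T.card ≤ Δ ^ n ∧
      ∀ p : Σ v, G.Walk u v, p.2.length = n → p ∈ T := by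
  induction n generalizing u with
  | zero =>
    refine ⟨{⟨u, Walk.nil⟩}, by simp, fun ⟨v, p⟩ hp => ?_⟩
    cases p with
    | nil => simp
    | cons => simp at hp
  | succ n ih =>
    choose T hT hmem using ih
    refine ⟨(Finset.univ : Finset (G.neighborSet u)).biUnion fun v =>
      (T v.1).image fun p : Σ w, G.Walk v.1 w =>
        (⟨p.1, Walk.cons v.2 p.2⟩ : Σ w, G.Walk u w), ?_, fun ⟨v, p⟩ hp => ?_⟩
    · refine (Finset.card_biUnion_le_card_mul _ _ (Δ ^ n) fun v _ =>
        Finset.card_image_le.trans (hT v.1)).trans ?_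
      rw [Finset.card_univ, card_neighborSet_eq_degree, pow_succ, mul_comm]
      exact Nat.mul_le_mul_left _ (hΔ u)
    · cases p with
      | nil => simp at hp
      | @cons _ w _ h p =>
        simp only [Finset.mem_biUnion, Finset.mem_image]
        exact ⟨⟨w, h⟩, Finset.mem_univ _, ⟨v, p⟩, hmem w _ (by simpa using hp), rfl⟩

theorem exists_finset_walk_length_le {Δ : ℕ} (hΔ : ∀ v, G.degree v ≤ Δ) (r : ℕ) (u : V) :
    ∃ A : Finset V, A.card ≤ (Δ + 1) ^ r ∧ ∀ v, ∀ p : G.Walk u v, p.length ≤ r → v ∈ A := by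
  induction r generalizing u with
  | zero =>
    refine ⟨{u}, by simp, fun v p hp => ?_⟩
    cases p with
    | nil => simp
    | cons => simp at hp
  | succ r ih =>
    choose A hA hmem using ih
    refine ⟨(insert u (G.neighborFinset u)).biUnion A, ?_, fun v p hp => ?_⟩
    · refine (Finset.card_biUnion_le_card_mul _ _ _ fun v _ => hA v).trans ?_
      rw [pow_succ, mul_comm]
      refine Nat.mul_le_mul_left _ ((Finset.card_insert_le _ _).trans ?_)
      rw [card_neighborFinset_eq_degree]
      exact Nat.add_le_add_right (hΔ u) 1
    · rw [Finset.mem_biUnion]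
      cases p with
      | nil => exact ⟨u, Finset.mem_insert_self _ _, hmem u u Walk.nil (by simp)⟩
      | @cons _ w _ h p =>
        exact ⟨w, Finset.mem_insert_of_mem (by simpa using h),
          hmem w v p (by simpa using hp)⟩

theorem finite_walk_length_eq {Δ : ℕ} (hΔ : ∀ v, G.degree v ≤ Δ) (u : V) (n : ℕ) :
    {p : Σ v, G.Walk u v | p.2.length = n}.Finite := by
  obtain ⟨T, -, hT⟩ := exists_finset_walk_length_eq hΔ n u
  exact T.finite_toSet.subset fun p hp => hT p hp

theorem finite_isCycle_length_eq {Δ : ℕ} (hΔ : ∀ v, G.degree v ≤ Δ) (u : V) (n : ℕ) :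
    Finite {w : G.Walk u u // w.IsCycle ∧ w.length = n} := by
  have := (finite_walk_length_eq hΔ u n).to_subtype
  let f : {w : G.Walk u u // w.IsCycle ∧ w.length = n} →
    {p : Σ v, G.Walk u v | p.2.length = n} := fun w => ⟨⟨u, w.1⟩, w.2.2⟩
  refine Finite.of_injective f fun w w' h => Subtype.ext ?_
  simpa [f] using h

theorem card_isCycle_length_eq_le {Δ : ℕ} (hΔ : ∀ v, G.degree v ≤ Δ) (u : V) (n : ℕ) :
    Nat.card {w : G.Walk u u // w.IsCycle ∧ w.length = n} ≤ Δ ^ n := by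
  obtain ⟨T, hTc, hT⟩ := exists_finset_walk_length_eq hΔ n u
  let f : {w : G.Walk u u // w.IsCycle ∧ w.length = n} → T := fun w => ⟨⟨u, w.1⟩, hT _ w.2.2⟩
  have hf : Function.Injective f := fun w w' h => Subtype.ext (by simpa [f] using h)
  refine (Nat.card_le_card_of_injective f hf).trans ?_
  simpa using hTc

theorem finite_isPath_length_eq {Δ : ℕ} (hΔ : ∀ v, G.degree v ≤ Δ) (u : V) (n : ℕ) :
    Finite {p : Σ v, G.Walk u v // p.2.IsPath ∧ p.2.length = n} :=
  ((finite_walk_length_eq hΔ u n).subset fun _ hp => hp.2).to_subtype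

end Counting

theorem card_isPath_length_eq_le_of_iso {u : V} (φ : G ≃g G) (n : ℕ)
    [Finite {p : Σ v, G.Walk (φ u) v // p.2.IsPath ∧ p.2.length = n}] :
    Nat.card {p : Σ v, G.Walk u v // p.2.IsPath ∧ p.2.length = n} ≤
      Nat.card {p : Σ v, G.Walk (φ u) v // p.2.IsPath ∧ p.2.length = n} := by
  let f : {p : Σ v, G.Walk u v // p.2.IsPath ∧ p.2.length = n} →
      {p : Σ v, G.Walk (φ u) v // p.2.IsPath ∧ p.2.length = n} := fun p =>
    ⟨⟨φ p.1.1, p.1.2.map φ.toHom⟩,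
      p.2.1.map φ.injective, by simpa using p.2.2⟩
  refine Nat.card_le_card_of_injective f ?_
  rintro ⟨⟨v, p⟩, hp⟩ ⟨⟨v', p'⟩, hp'⟩ h
  simp only [f, Subtype.mk.injEq, Sigma.mk.injEq] at h
  obtain rfl := φ.injective h.1
  have := Walk.map_injective_of_injective (f := φ.toHom) φ.injective _ _ (eq_of_heq h.2)
  subst this
  rfl

theorem tsum_isCycle_le_of_iso {u : V} (φ : G ≃g G) (z : ℝ≥0∞) :
    ∑' C : {w : G.Walk u u // w.IsCycle}, z ^ C.1.length ≤
      ∑' C : {w : G.Walk (φ u) (φ u) // w.IsCycle}, z ^ C.1.length := by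
  let f : {w : G.Walk u u // w.IsCycle} → {w : G.Walk (φ u) (φ u) // w.IsCycle} := fun w =>
    ⟨w.1.map φ.toHom, (Walk.isCycle_map_iff_of_injective φ.injective).mpr w.2⟩
  have hf : Function.Injective f := fun w w' h => Subtype.ext
    (Walk.map_injective_of_injective (f := φ.toHom) φ.injective _ _ (congrArg Subtype.val h))
  refine le_trans (le_of_eq (tsum_congr fun C => ?_))
    (ENNReal.tsum_comp_le_tsum_of_injective hf _)
  simp [f]

/-- The number of self-avoiding walks is submultiplicative. -/
theorem card_isPath_length_add_le {u : V} {m n N : ℕ}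
    (hfin : ∀ v k, Finite {p : Σ w, G.Walk v w // p.2.IsPath ∧ p.2.length = k})
    (hN : ∀ v, Nat.card {p : Σ w, G.Walk v w // p.2.IsPath ∧ p.2.length = n} ≤ N) :
    Nat.card {p : Σ v, G.Walk u v // p.2.IsPath ∧ p.2.length = m + n} ≤
      Nat.card {p : Σ v, G.Walk u v // p.2.IsPath ∧ p.2.length = m} * N := by
  have := Fintype.ofFinite {p : Σ v, G.Walk u v // p.2.IsPath ∧ p.2.length = m}
  let join : (Σ a : {p : Σ v, G.Walk u v // p.2.IsPath ∧ p.2.length = m},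
      {p : Σ w, G.Walk a.1.1 w // p.2.IsPath ∧ p.2.length = n}) → Σ v, G.Walk u v :=
    fun x => ⟨x.2.1.1, x.1.1.2.append x.2.1.2⟩
  have hex : ∀ p : {p : Σ v, G.Walk u v // p.2.IsPath ∧ p.2.length = m + n},
      ∃ x, join x = p.1 := fun ⟨⟨v, p⟩, hp, hl⟩ =>
    ⟨⟨⟨⟨_, p.take m⟩, hp.take m, by simp_all [Walk.take_length]⟩,
      ⟨⟨_, p.drop m⟩, hp.drop m, by simp_all [Walk.drop_length]⟩⟩, by simp [join]⟩
  choose split hsplit using hex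
  have hinj : Function.Injective split := fun p p' h =>
    Subtype.ext (by rw [← hsplit p, ← hsplit p', h])
  refine (Nat.card_le_card_of_injective split hinj).trans ?_
  rw [Nat.card_sigma]
  refine (Finset.sum_le_card_nsmul _ _ N fun a _ => hN a.1.1).trans ?_
  rw [Finset.card_univ, smul_eq_mul, Nat.card_eq_fintype_card]

theorem tsum_isCycle_eq {u : V}
    (hfin : ∀ n, Finite {w : G.Walk u u // w.IsCycle ∧ w.length = n}) (z : ℝ≥0∞) :
    ∑' C : {w : G.Walk u u // w.IsCycle}, z ^ C.1.length =
      ∑' n : ℕ, (Nat.card {w : G.Walk u u // w.IsCycle ∧ w.length = n} : ℝ≥0∞) * z ^ n := by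
  rw [← ENNReal.tsum_fiberwise _ fun C : {w : G.Walk u u // w.IsCycle} => C.1.length]
  refine tsum_congr fun n => ?_
  have e : ((fun C : {w : G.Walk u u // w.IsCycle} => C.1.length) ⁻¹' {n}) ≃
      {w : G.Walk u u // w.IsCycle ∧ w.length = n} :=
    Equiv.subtypeSubtypeEquivSubtypeInter (fun w : G.Walk u u => w.IsCycle) fun w => w.length = n
  have := hfin n
  have : Finite ((fun C : {w : G.Walk u u // w.IsCycle} => C.1.length) ⁻¹' {n}) :=
    Finite.of_equiv _ e.symm
  calc _ = ∑' _ : ((fun C : {w : G.Walk u u // w.IsCycle} => C.1.length) ⁻¹' {n}), z ^ n :=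
        tsum_congr fun C => by rw [show C.1.1.length = n from C.2]
    _ = _ := by rw [ENNReal.tsum_const, ENat.card_eq_coe_natCard, Nat.card_congr e]; simp

/-- If the generating function of cycles converges at `x⁻¹`, the number of paths of length `n`
between two vertices is at most `K ^ d * x ^ n`, where `d` is their distance. -/
theorem exists_card_isPath_le {x : ℝ} (hx : 0 < x) {P : ℝ≥0∞} (hPt : P ≠ ⊤)
    (hP : ∀ v, ∑' C : {w : G.Walk v v // w.IsCycle}, ENNReal.ofReal x⁻¹ ^ C.1.length ≤ P)
    (hconn : G.Connected)
    (hfin : ∀ (u v : V) (n : ℕ), Finite {p : G.Walk u v // p.IsPath ∧ p.length = n}) :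
    ∃ K : ℝ, 1 ≤ K ∧ ∀ (u v : V) (n : ℕ),
      (Nat.card {p : G.Walk u v // p.IsPath ∧ p.length = n} : ℝ) ≤ K ^ G.dist u v * x ^ n := by
  set m : ℝ := min 1 (min x⁻¹ x)
  have hx' : 0 < x⁻¹ := inv_pos.mpr hx
  have hm0 : 0 < m := lt_min one_pos (lt_min hx' hx)
  have hm1 : m ≤ 1 := min_le_left _ _
  refine ⟨(1 + P.toReal) / m, ?_, fun u v n => ?_⟩
  · rw [le_div_iff₀ hm0]
    have := P.toReal_nonneg
    linarith
  obtain ⟨q, hq, hql⟩ := hconn.exists_path_of_dist u v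
  have := hfin u v n
  have key := tsum_isPath_le (z := ENNReal.ofReal x⁻¹) (m := ENNReal.ofReal m)
    (by simpa using hx) ENNReal.ofReal_ne_top (by simpa using hm1)
    (ENNReal.ofReal_le_ofReal ((min_le_right _ _).trans (min_le_left _ _)))
    (by
      rw [← ENNReal.ofReal_inv_of_pos hx', inv_inv]
      exact ENNReal.ofReal_le_ofReal ((min_le_right _ _).trans (min_le_right _ _))) hP hq n
  rw [ENNReal.tsum_const, ENat.card_eq_coe_natCard, hql] at key
  have key' := ENNReal.toReal_mono (by simp [hPt]) key
  simp only [ENNReal.toReal_mul, ENNReal.toReal_pow, ENNReal.toReal_ofReal hm0.le,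
    ENNReal.toReal_ofReal hx'.le, ENNReal.toReal_add ENNReal.one_ne_top hPt,
    ENNReal.toReal_one, ENat.toENNReal_coe, ENNReal.toReal_natCast] at key'
  rw [div_pow, div_mul_eq_mul_div, le_div_iff₀ (pow_pos hm0 _)]
  calc (Nat.card {p : G.Walk u v // p.IsPath ∧ p.length = n} : ℝ) * m ^ G.dist u v
      = (Nat.card {p : G.Walk u v // p.IsPath ∧ p.length = n} *
          (m ^ G.dist u v * x⁻¹ ^ n)) * x ^ n := by
        rw [inv_pow]
        field_simp
    _ ≤ _ := mul_le_mul_of_nonneg_right key' (pow_nonneg hx.le n)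

/-- Exponential bound on the number of paths of length `n` ending within distance `r`. -/
theorem card_isPath_dist_le {Δ : ℕ} {K x : ℝ} (hK : 1 ≤ K) (hx : 0 < x) [G.LocallyFinite]
    (hΔ : ∀ v, G.degree v ≤ Δ) (hconn : G.Connected) (o : V)
    (hKx : ∀ (v : V) (n : ℕ),
      (Nat.card {p : G.Walk o v // p.IsPath ∧ p.length = n} : ℝ) ≤ K ^ G.dist o v * x ^ n)
    (hfin : ∀ (v : V) (n : ℕ), Finite {p : G.Walk o v // p.IsPath ∧ p.length = n})
    (r n : ℕ) :
    (Nat.card {p : Σ v, G.Walk o v // p.2.IsPath ∧ p.2.length = n ∧ G.dist o p.1 ≤ r} : ℝ) ≤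
      ((Δ + 1) * K) ^ r * x ^ n := by
  obtain ⟨A, hA, hmem⟩ := exists_finset_walk_length_le hΔ r o
  have hS : {p : Σ v, G.Walk o v | p.2.IsPath ∧ p.2.length = n ∧ G.dist o p.1 ≤ r}.Finite :=
    (finite_walk_length_eq hΔ o n).subset fun p hp => hp.2.1
  have hcard : Nat.card {p : Σ v, G.Walk o v // p.2.IsPath ∧ p.2.length = n ∧ G.dist o p.1 ≤ r}
      = hS.toFinset.card := Nat.card_eq_card_finite_toFinset hS
  have hmaps : ∀ p ∈ hS.toFinset, p.1 ∈ A := fun p hp => by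
    obtain ⟨q, -, hq⟩ := hconn.exists_path_of_dist o p.1
    exact hmem _ q (hq.trans_le (hS.mem_toFinset.mp hp).2.2)
  rw [hcard, Finset.card_eq_sum_card_fiberwise hmaps, Nat.cast_sum]
  have hfiber : ∀ v ∈ A, ((hS.toFinset.filter fun p => p.1 = v).card : ℝ) ≤ K ^ r * x ^ n := by
    intro v _
    rcases (hS.toFinset.filter fun p => p.1 = v).eq_empty_or_nonempty with h | ⟨p, hp⟩
    · rw [h, Finset.card_empty, Nat.cast_zero]
      positivity
    have hd : G.dist o v ≤ r := by
      obtain ⟨hp', rfl⟩ := Finset.mem_filter.mp hp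
      exact (hS.mem_toFinset.mp hp').2.2
    have := hfin v n
    have := Fintype.ofFinite {p : G.Walk o v // p.IsPath ∧ p.length = n}
    refine le_trans ?_ ((hKx v n).trans
      (mul_le_mul_of_nonneg_right (pow_le_pow_right₀ hK hd) (by positivity)))
    rw [Nat.cast_le, Nat.card_eq_fintype_card, ← Finset.card_univ]
    refine (Finset.card_le_card (t := Finset.univ.image fun p :
      {p : G.Walk o v // p.IsPath ∧ p.length = n} => (⟨v, p.1⟩ : Σ v, G.Walk o v)) ?_).trans
      Finset.card_image_le
    rintro ⟨w, p⟩ hp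
    obtain ⟨hp', rfl⟩ := Finset.mem_filter.mp hp
    have hp' := hS.mem_toFinset.mp hp'
    exact Finset.mem_image.mpr ⟨⟨p, hp'.1, hp'.2.1⟩, Finset.mem_univ _, rfl⟩
  refine (Finset.sum_le_card_nsmul _ _ _ hfiber).trans ?_
  rw [nsmul_eq_mul, mul_pow, mul_assoc]
  refine mul_le_mul_of_nonneg_right ?_ (by positivity)
  exact_mod_cast hA

end SimpleGraph

/-- If `μ_p < μ_w` on a connected, locally finite, vertex-transitive graph, then
the self-avoiding walk is ballistic: all but an exponentially small fraction of
`n`-step SAWs from `o` end at distance at least `ε n` from `o`. -/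
theorem saw_ballistic_of_mu_p_lt_mu_w
    {V : Type*} [Countable V] (G : SimpleGraph V)
    (hconn : G.Connected) (hlf : G.LocallyFinite)
    (htrans : ∀ u v : V, ∃ φ : G ≃g G, φ u = v) (o : V)
    (cn pn : ℕ → ℕ)
    (hc : ∀ n : ℕ, cn n =
      Nat.card {p : Σ v : V, G.Walk o v // p.2.IsPath ∧ p.2.length = n})
    (hp : ∀ n : ℕ, pn n =
      Nat.card {w : G.Walk o o // w.IsCycle ∧ w.length = n})
    (hμ : limsup (fun n : ℕ => (pn n : ℝ) ^ (1 / (n : ℝ))) atTop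
        < limsup (fun n : ℕ => (cn n : ℝ) ^ (1 / (n : ℝ))) atTop) :
    ∃ ε : ℝ, 0 < ε ∧ ∃ c : ℝ, 0 < c ∧ ∀ n : ℕ, 1 ≤ n →
      (Nat.card {p : Σ v : V, G.Walk o v //
          p.2.IsPath ∧ p.2.length = n ∧ (G.dist o p.1 : ℝ) < ε * n} : ℝ)
        ≤ Real.exp (-c * n) * cn n := by
  have hΔ : ∀ v, G.degree v ≤ G.degree o := fun v => by
    obtain ⟨φ, rfl⟩ := htrans o v
    exact (φ.degree_eq o).le
  have hfinP : ∀ v k, Finite {p : Σ w, G.Walk v w // p.2.IsPath ∧ p.2.length = k} :=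
    G.finite_isPath_length_eq hΔ
  have hfinP' : ∀ (u v : V) (k : ℕ), Finite {p : G.Walk u v // p.IsPath ∧ p.length = k} :=
    fun u v k => by
      have := hfinP u k
      let f : {p : G.Walk u v // p.IsPath ∧ p.length = k} →
          {p : Σ w, G.Walk u w // p.2.IsPath ∧ p.2.length = k} := fun p => ⟨⟨v, p.1⟩, p.2⟩
      exact Finite.of_injective f fun p p' h => Subtype.ext (by simpa [f] using h)
  have hsub : ∀ m n, cn (m + n) ≤ cn m * cn n := fun m n => by
    rw [hc, hc m]
    refine SimpleGraph.card_isPath_length_add_le hfinP fun v => ?_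
    obtain ⟨φ, rfl⟩ := htrans v o
    rw [hc]
    exact SimpleGraph.card_isPath_length_eq_le_of_iso φ n
  have hpΔ : ∀ n, pn n ≤ G.degree o ^ n := fun n => by
    rw [hp]
    exact SimpleGraph.card_isCycle_length_eq_le hΔ o n
  have hp0 : 0 ≤ limsup (fun n : ℕ => (pn n : ℝ) ^ (1 / (n : ℝ))) atTop :=
    le_limsup_of_frequently_le (Frequently.of_forall fun n => by positivity)
      (isBoundedUnder_rpow_one_div hpΔ)
  set w := limsup (fun n : ℕ => (cn n : ℝ) ^ (1 / (n : ℝ))) atTop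
  obtain ⟨x, hpx, hxw⟩ := exists_between hμ
  have hx : 0 < x := hp0.trans_lt hpx
  have hw0 : 0 < w := hx.trans hxw
  obtain ⟨K, hK, hKx⟩ := SimpleGraph.exists_card_isPath_le hx
    (tsum_mul_ofReal_pow_ne_top hpΔ hx hpx) (fun v => by
      obtain ⟨φ, rfl⟩ := htrans v o
      refine (SimpleGraph.tsum_isCycle_le_of_iso φ _).trans (le_of_eq ?_)
      rw [SimpleGraph.tsum_isCycle_eq (SimpleGraph.finite_isCycle_length_eq hΔ _)]
      simp only [hp]) hconn hfinP'
  set B : ℝ := ((G.degree o : ℕ) + 1) * K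
  have hB1 : 1 ≤ B := one_le_mul_of_one_le_of_one_le (by simp) hK
  have hlogB : 0 ≤ Real.log B := Real.log_nonneg hB1
  set δ := Real.log (w / x) with hδ
  have hδ0 : 0 < δ := Real.log_pos ((one_lt_div hx).mpr hxw)
  set ε := δ / (2 * (Real.log B + 1)) with hε
  have hε0 : 0 < ε := by positivity
  refine ⟨ε, hε0, δ / 2, by positivity, fun n hn => ?_⟩
  have hle : w ^ n ≤ cn n := pow_limsup_le_of_submultiplicative hsub hn hw0.le
  set r := ⌊ε * n⌋₊
  have hr : (r : ℝ) ≤ ε * n := Nat.floor_le (by positivity)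
  have hball := SimpleGraph.card_isPath_dist_le hK hx hΔ hconn o (hKx o) (hfinP' o) r n
  have hfinB : Finite {p : Σ v, G.Walk o v //
      p.2.IsPath ∧ p.2.length = n ∧ G.dist o p.1 ≤ r} :=
    ((SimpleGraph.finite_walk_length_eq hΔ o n).subset fun _ hp => hp.2.1).to_subtype
  have hbad : Nat.card {p : Σ v, G.Walk o v //
      p.2.IsPath ∧ p.2.length = n ∧ (G.dist o p.1 : ℝ) < ε * n} ≤
      Nat.card {p : Σ v, G.Walk o v // p.2.IsPath ∧ p.2.length = n ∧ G.dist o p.1 ≤ r} :=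
    Nat.card_le_card_of_injective _
      (Subtype.map_injective (fun _ h => ⟨h.1, h.2.1, Nat.le_floor h.2.2.le⟩)
        Function.injective_id)
  have hBr : B ^ r ≤ Real.exp (δ / 2 * n) := by
    rw [← Real.exp_log (one_pos.trans_le hB1), ← Real.exp_nat_mul, Real.exp_le_exp]
    calc (r : ℝ) * Real.log B ≤ ε * n * (Real.log B + 1) := by
          gcongr
          linarith
      _ = δ / 2 * n := by
          rw [hε]
          field_simp
  have hxn : x ^ n = Real.exp (-δ * n) * w ^ n := by
    have : x = Real.exp (-δ) * w := by
      rw [hδ, Real.exp_neg, Real.exp_log (by positivity)]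
      field_simp
    rw [this, mul_pow, ← Real.exp_nat_mul, mul_comm (n : ℝ)]
  calc (Nat.card {p : Σ v, G.Walk o v //
        p.2.IsPath ∧ p.2.length = n ∧ (G.dist o p.1 : ℝ) < ε * n} : ℝ)
      ≤ B ^ r * x ^ n := (Nat.cast_le.mpr hbad).trans hball
    _ ≤ Real.exp (δ / 2 * n) * (Real.exp (-δ * n) * w ^ n) := by
        rw [← hxn]
        gcongr
    _ = Real.exp (-(δ / 2) * n) * w ^ n := by
        rw [← mul_assoc, ← Real.exp_add]
        ring_nf
    _ ≤ Real.exp (-(δ / 2) * n) * cn n := by gcongr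
end

section
/- Let G be a connected simple graph of maximum degree at most D (D ≥ 2). For each vertex x let c_n(x) be the number of self-avoiding walks of length n starting at x, and let p_n(x) be the number of closed walks of length n from x to x that are cycles. If limsup_{n→∞} (sup_x p_n(x))^{1/n} < liminf_{n→∞} (inf_x c_n(x))^{1/n}, then there exist ε > 0 and c > 0 such that for every vertex x and every n ≥ 1, the number of self-avoiding walks w of length n starting at x with d_G(x, w(n)) < εn is at most e^{-cn} · c_n(x). -/
open Filter

namespace SimpleGraph

variable {V : Type*} {G : SimpleGraph V}

/-- In a graph of maximum degree at most `D`, there are at most `D ^ n` walks of length `n`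
from any given vertex. -/
lemma exists_finset_walks_length_eq {D : ℕ} (hfin : ∀ v, (G.neighborSet v).Finite)
    (hdeg : ∀ v, (G.neighborSet v).ncard ≤ D) (n : ℕ) (x : V) :
    ∃ s : Finset (Σ v, G.Walk x v), (∀ p, p ∈ s ↔ p.2.length = n) ∧ s.card ≤ D ^ n := by
  classical
  induction n generalizing x with
  | zero =>
    refine ⟨{⟨x, Walk.nil⟩}, ?_, by simp⟩
    rintro ⟨v, _ | ⟨h, p⟩⟩
    · simp
    · simp only [Finset.mem_singleton, Sigma.mk.injEq, Walk.length_cons, Nat.add_eq_zero_iff,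
        one_ne_zero, and_false, iff_false, not_and]
      rintro rfl he
      simpa using eq_of_heq he
  | succ n ih =>
    choose s hs hcard using ih
    refine ⟨(hfin x).toFinset.attach.biUnion fun u => (s u).image fun p =>
      ⟨p.1, Walk.cons ((hfin x).mem_toFinset.1 u.2) p.2⟩, ?_, ?_⟩
    · rintro ⟨v, _ | ⟨h, p⟩⟩
      · simp only [Finset.mem_biUnion, Finset.mem_attach, Finset.mem_image, true_and,
          Walk.length_nil, (Nat.succ_ne_zero n).symm, iff_false, not_exists, not_and,
          Sigma.mk.injEq]
        rintro u ⟨a, q⟩ - (ha : a = x) he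
        subst ha
        exact absurd (congrArg Walk.length (eq_of_heq he)) (Nat.succ_ne_zero q.length)
      · simp only [Finset.mem_biUnion, Finset.mem_attach, Finset.mem_image, true_and, hs,
          Walk.length_cons, Nat.add_right_cancel_iff]
        constructor
        · rintro ⟨u, q, hq, he⟩
          obtain ⟨a, q⟩ := q
          obtain ⟨u, hu⟩ := u
          simp only [Sigma.mk.injEq] at he
          obtain ⟨rfl, he⟩ := he
          have hlen : q.length + 1 = p.length + 1 := congrArg Walk.length (eq_of_heq he)
          exact (Nat.succ_injective hlen).symm.trans hq
        · intro hp
          exact ⟨⟨_, (hfin x).mem_toFinset.2 h⟩, ⟨v, p⟩, hp, rfl⟩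
    · calc _ ≤ (hfin x).toFinset.attach.card * D ^ n :=
            Finset.card_biUnion_le_card_mul _ _ _ fun u _ =>
              Finset.card_image_le.trans (hcard u)
        _ ≤ D ^ (n + 1) := by
            rw [Finset.card_attach, ← Set.ncard_eq_toFinset_card _ (hfin x), pow_succ']
            exact Nat.mul_le_mul_right _ (hdeg x)

/-- The self-avoiding walks of length `n` from `x` to `y`. -/
def pathsOfLength (G : SimpleGraph V) (x y : V) (n : ℕ) : Set (G.Walk x y) :=
  {w | w.IsPath ∧ w.length = n}

lemma finite_setOf_walk_length_eq (hfin : ∀ v, (G.neighborSet v).Finite)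
    {D : ℕ} (hdeg : ∀ v, (G.neighborSet v).ncard ≤ D) (x y : V) (n : ℕ) :
    {w : G.Walk x y | w.length = n}.Finite ∧ {w : G.Walk x y | w.length = n}.ncard ≤ D ^ n := by
  obtain ⟨s, hs, hcard⟩ := exists_finset_walks_length_eq hfin hdeg n x
  have hmaps : ∀ w ∈ {w : G.Walk x y | w.length = n},
      (⟨y, w⟩ : Σ v, G.Walk x v) ∈ (s : Set (Σ v, G.Walk x v)) := fun w hw => (hs _).2 hw
  have hinj : Set.InjOn (fun w : G.Walk x y => (⟨y, w⟩ : Σ v, G.Walk x v))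
      {w : G.Walk x y | w.length = n} := sigma_mk_injective.injOn
  refine ⟨Set.Finite.of_finite_image
    (s.finite_toSet.subset (Set.image_subset_iff.2 hmaps)) hinj, ?_⟩
  have := Set.ncard_le_ncard_of_injOn _ hmaps hinj s.finite_toSet
  rw [Set.ncard_coe_finset] at this
  exact this.trans hcard

/-- Splitting the self-avoiding walks from `x` to `y` according to whether they visit the
neighbour `z` of `x`. -/
lemma ncard_pathsOfLength_le {x y z : V} (h : G.Adj x z) (n : ℕ)
    (hf : ∀ a b k, (G.pathsOfLength a b k).Finite) :
    (G.pathsOfLength x y n).ncard ≤ (G.pathsOfLength z y (n + 1)).ncard +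
      ∑ k ∈ Finset.range (n + 1),
        (G.pathsOfLength x z k).ncard * (G.pathsOfLength z y (n - k)).ncard := by
  classical
  have hsub : G.pathsOfLength x y n ⊆ {w ∈ G.pathsOfLength x y n | z ∉ w.support} ∪
      ↑((Finset.range (n + 1)).biUnion fun k => Finset.image₂ Walk.append
        (hf x z k).toFinset (hf z y (n - k)).toFinset) := by
    intro w hw
    by_cases hz : z ∈ w.support
    · right
      have hlen := congrArg Walk.length (w.take_spec hz)
      rw [Walk.length_append, hw.2] at hlen
      simp only [Finset.coe_biUnion, Set.mem_iUnion, Finset.mem_coe, Finset.mem_range,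
        Finset.mem_image₂, Set.Finite.mem_toFinset]
      exact ⟨(w.takeUntil z hz).length, by omega, _, ⟨hw.1.takeUntil hz, rfl⟩, _,
        ⟨hw.1.dropUntil hz, by omega⟩, w.take_spec hz⟩
    · exact Or.inl ⟨hw, hz⟩
  refine (Set.ncard_le_ncard hsub (((hf x y n).subset (Set.sep_subset _ _)).union
    (Finset.finite_toSet _))).trans ((Set.ncard_union_le _ _).trans (add_le_add ?_ ?_))
  · refine Set.ncard_le_ncard_of_injOn (Walk.cons h.symm) ?_ ?_ (hf _ _ _)
    · rintro w ⟨hw, hz⟩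
      exact ⟨hw.1.cons hz, by simp [hw.2]⟩
    · intro w _ w' _ he
      simpa using he
  · rw [Set.ncard_coe_finset]
    refine Finset.card_biUnion_le.trans (Finset.sum_le_sum fun k _ => ?_)
    refine (Finset.card_image₂_le _ _ _).trans_eq ?_
    rw [← Set.ncard_eq_toFinset_card _ (hf _ _ _), ← Set.ncard_eq_toFinset_card _ (hf _ _ _)]

/-- A self-avoiding walk of length at least two between neighbours closes up to a cycle. -/
lemma ncard_pathsOfLength_le_ncard_isCycle {x z : V} (h : G.Adj x z) {k : ℕ} (hk : 2 ≤ k)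
    (hf : {w : G.Walk z z | w.length = k + 1}.Finite) :
    (G.pathsOfLength x z k).ncard ≤ {w : G.Walk z z | w.IsCycle ∧ w.length = k + 1}.ncard := by
  refine Set.ncard_le_ncard_of_injOn (Walk.cons h.symm) ?_ ?_ (hf.subset fun w hw => hw.2)
  · rintro w ⟨hw, hlen⟩
    refine ⟨(Walk.cons_isCycle_iff _ _).2 ⟨hw, fun he => ?_⟩, by simp [hlen]⟩
    have := hw.length_eq_one_of_mem_edges (Sym2.eq_swap ▸ he)
    omega
  · intro w _ w' _ he
    simpa using he

/-- If the number of self-avoiding walks of length `k` between neighbours is at most `C * ρ ^ k`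
with `ρ < μ`, then, for some constant `A`, the number of self-avoiding
walks of length `n` between the ends of a walk of length `d` is at most `A ^ d * μ ^ n`. -/
lemma ncard_pathsOfLength_le_pow {ρ μ C : ℝ} (hρ : 0 < ρ) (hρμ : ρ < μ) (hC : 0 ≤ C)
    (hf : ∀ a b k, (G.pathsOfLength a b k).Finite)
    (hadj : ∀ x z k, G.Adj x z → ((G.pathsOfLength x z k).ncard : ℝ) ≤ C * ρ ^ k)
    {x y : V} (v : G.Walk x y) (n : ℕ) :
    ((G.pathsOfLength x y n).ncard : ℝ) ≤ (μ + C / (1 - ρ / μ)) ^ v.length * μ ^ n := by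
  have hμ : 0 < μ := hρ.trans hρμ
  have hr : ρ / μ < 1 := (div_lt_one hμ).2 hρμ
  have hA : 0 ≤ μ + C / (1 - ρ / μ) := by
    have : 0 < 1 - ρ / μ := by linarith
    positivity
  induction v generalizing n with
  | nil =>
    rename_i u
    simp only [Walk.length_nil, pow_zero, one_mul]
    rcases n with _ | n
    · have hsub : G.pathsOfLength u u 0 ⊆ {Walk.nil} := fun w hw => by
        simpa using (Walk.isPath_iff_nil.1 hw.1).eq_nil
      have := Set.ncard_le_ncard hsub
      rw [Set.ncard_singleton] at this
      simpa using this
    · have hempty : G.pathsOfLength u u (n + 1) = ∅ := by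
        ext w
        simp only [Set.mem_empty_iff_false, iff_false]
        rintro ⟨hw, hl⟩
        rw [(Walk.isPath_iff_nil.1 hw).eq_nil] at hl
        simp at hl
      simp only [hempty, Set.ncard_empty, Nat.cast_zero]
      positivity
  | @cons x z y h p ih =>
    set A := μ + C / (1 - ρ / μ) with hAdef
    have hgeom : ∑ k ∈ Finset.range (n + 1), (ρ / μ) ^ k ≤ 1 / (1 - ρ / μ) := by
      have := Summable.sum_le_tsum (Finset.range (n + 1))
        (fun k _ => by positivity) (summable_geometric_of_lt_one (by positivity) hr)
      rwa [tsum_geometric_of_lt_one (by positivity) hr, ← one_div] at this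
    have hterm : ∀ k ∈ Finset.range (n + 1),
        ((G.pathsOfLength x z k).ncard : ℝ) * (G.pathsOfLength z y (n - k)).ncard ≤
          C * A ^ p.length * μ ^ n * (ρ / μ) ^ k := by
      intro k hk
      have hkn : k ≤ n := Nat.lt_succ_iff.1 (Finset.mem_range.1 hk)
      calc _ ≤ (C * ρ ^ k) * (A ^ p.length * μ ^ (n - k)) :=
            mul_le_mul (hadj x z k h) (ih (n - k)) (by positivity) (by positivity)
        _ = _ := by
            rw [div_pow, pow_sub₀ _ hμ.ne' hkn]
            ring
    calc ((G.pathsOfLength x y n).ncard : ℝ)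
        ≤ (G.pathsOfLength z y (n + 1)).ncard + ∑ k ∈ Finset.range (n + 1),
          ((G.pathsOfLength x z k).ncard : ℝ) * (G.pathsOfLength z y (n - k)).ncard := by
            exact_mod_cast ncard_pathsOfLength_le h n hf
      _ ≤ A ^ p.length * μ ^ (n + 1) + ∑ k ∈ Finset.range (n + 1),
          C * A ^ p.length * μ ^ n * (ρ / μ) ^ k :=
            add_le_add (ih _) (Finset.sum_le_sum hterm)
      _ ≤ A ^ p.length * μ ^ (n + 1) + C * A ^ p.length * μ ^ n * (1 / (1 - ρ / μ)) := by
            rw [← Finset.mul_sum]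
            gcongr
      _ = A ^ (Walk.cons h p).length * μ ^ n := by
            rw [Walk.length_cons, hAdef]
            ring

/-- The self-avoiding walks of length `n` from `x` ending within distance `r` of `x` are at most
`∑ d ≤ r, (D * A) ^ d * B` if those ending at the end of a walk of length `d` are at most
`A ^ d * B`. -/
lemma ncard_setOf_dist_le {D : ℕ} (hconn : G.Connected) (hfin : ∀ v, (G.neighborSet v).Finite)
    (hdeg : ∀ v, (G.neighborSet v).ncard ≤ D) {A B : ℝ} (hA : 0 ≤ A) (hB : 0 ≤ B)
    {x : V} {n : ℕ} (hf : ∀ a b k, (G.pathsOfLength a b k).Finite)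
    (hq : ∀ y (v : G.Walk x y), ((G.pathsOfLength x y n).ncard : ℝ) ≤ A ^ v.length * B) (r : ℕ) :
    ({p : Σ v, G.Walk x v | p.2.IsPath ∧ p.2.length = n ∧ G.dist x p.1 ≤ r}.ncard : ℝ) ≤
      ∑ d ∈ Finset.range (r + 1), (D * A) ^ d * B := by
  classical
  choose s hs hcard using fun d => exists_finset_walks_length_eq hfin hdeg d x
  let T : Finset (Σ v, G.Walk x v) := (Finset.range (r + 1)).biUnion fun d =>
    (s d).biUnion fun q => (hf x q.1 n).toFinset.image (Sigma.mk q.1)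
  have hsub : {p : Σ v, G.Walk x v | p.2.IsPath ∧ p.2.length = n ∧ G.dist x p.1 ≤ r} ⊆ T := by
    rintro ⟨y, w⟩ ⟨hw, hl, hd⟩
    obtain ⟨v, hv⟩ := hconn.exists_walk_length_eq_dist x y
    simp only [T, Finset.mem_coe, Finset.mem_biUnion, Finset.mem_range, Finset.mem_image,
      Set.Finite.mem_toFinset]
    exact ⟨G.dist x y, Nat.lt_succ_of_le hd, ⟨y, v⟩, (hs _ _).2 hv, w, ⟨hw, hl⟩, rfl⟩
  have h1 : {p : Σ v, G.Walk x v | p.2.IsPath ∧ p.2.length = n ∧ G.dist x p.1 ≤ r}.ncard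
      ≤ T.card := by
    simpa using Set.ncard_le_ncard hsub T.finite_toSet
  have h2 : T.card ≤ ∑ d ∈ Finset.range (r + 1), ∑ q ∈ s d, (G.pathsOfLength x q.1 n).ncard := by
    refine Finset.card_biUnion_le.trans (Finset.sum_le_sum fun d _ => ?_)
    refine Finset.card_biUnion_le.trans (Finset.sum_le_sum fun q _ => ?_)
    exact Finset.card_image_le.trans_eq (Set.ncard_eq_toFinset_card _ (hf _ _ _)).symm
  calc _ ≤ ((∑ d ∈ Finset.range (r + 1), ∑ q ∈ s d, (G.pathsOfLength x q.1 n).ncard : ℕ) : ℝ) :=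
        Nat.cast_le.2 (h1.trans h2)
    _ = ∑ d ∈ Finset.range (r + 1), ∑ q ∈ s d, ((G.pathsOfLength x q.1 n).ncard : ℝ) := by
        push_cast; rfl
    _ ≤ _ := by
        refine Finset.sum_le_sum fun d _ => ?_
        calc _ ≤ ∑ q ∈ s d, A ^ d * B :=
              Finset.sum_le_sum fun q hqs => by simpa [(hs d q).1 hqs] using hq q.1 q.2
          _ = (s d).card * (A ^ d * B) := by simp
          _ ≤ (D : ℝ) ^ d * (A ^ d * B) := by
              gcongr
              exact_mod_cast hcard d
          _ = _ := by ring

/-- If, for all large `n`, every vertex starts a finite nonzero number of self-avoiding walks of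
length `n`, then the graph is locally finite. -/
lemma finite_neighborSet_of_card_pos {N : ℕ}
    (hpos : ∀ n, N ≤ n → ∀ x : V,
      0 < Nat.card {p : Σ v : V, G.Walk x v // p.2.IsPath ∧ p.2.length = n}) (v : V) :
    (G.neighborSet v).Finite := by
  by_contra hinf
  obtain ⟨⟨⟨⟨w, p⟩, hp, hl⟩⟩, -⟩ := Nat.card_pos_iff.1 (hpos N le_rfl v)
  obtain ⟨-, hfin⟩ := Nat.card_pos_iff.1 (hpos (N + 1) (Nat.le_succ N) w)
  have hinf' : (G.neighborSet v \ {u | u ∈ p.support}).Infinite :=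
    Set.Infinite.sdiff hinf p.support.finite_toSet
  have := hinf'.to_subtype
  let f : ↥(G.neighborSet v \ {u | u ∈ p.support}) →
      {q : Σ u : V, G.Walk w u // q.2.IsPath ∧ q.2.length = N + 1} := fun u =>
    ⟨⟨u, p.reverse.concat u.2.1⟩, hp.reverse.concat (by simpa using u.2.2) _, 
      (p.reverse.length_concat _).trans (by simpa using hl)⟩
  have hf : Function.Injective f := fun a b hab =>
    Subtype.ext (congrArg (fun q => q.1.1) hab)
  exact not_finite_iff_infinite.2 (Infinite.of_injective f hf) hfin

end SimpleGraph

/-- On a connected graph of maximum degree at most `D`, if the uniform (over vertices)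
exponential growth rate of cycle counts is strictly smaller than the uniform growth rate
of self-avoiding walk counts, then the self-avoiding walk is ballistic from every vertex. -/
theorem saw_ballistic_of_uniform_growth_gap
    {V : Type*} [Countable V] (G : SimpleGraph V)
    (hconn : G.Connected) (D : ℕ) (hD : 2 ≤ D)
    (hdeg : ∀ v : V, (G.neighborSet v).ncard ≤ D)
    (cn : V → ℕ → ℕ) (pn : V → ℕ → ℕ)
    (hc : ∀ x : V, ∀ n : ℕ, cn x n =
      Nat.card {p : Σ v : V, G.Walk x v // p.2.IsPath ∧ p.2.length = n})
    (hp : ∀ x : V, ∀ n : ℕ, pn x n =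
      Nat.card {w : G.Walk x x // w.IsCycle ∧ w.length = n})
    (hlim : limsup (fun n : ℕ => (⨆ x : V, (pn x n : ℝ)) ^ (1 / (n : ℝ))) atTop
        < liminf (fun n : ℕ => (⨅ x : V, (cn x n : ℝ)) ^ (1 / (n : ℝ))) atTop) :
    ∃ ε : ℝ, 0 < ε ∧ ∃ c : ℝ, 0 < c ∧ ∀ x : V, ∀ n : ℕ, 1 ≤ n →
      (Nat.card {p : Σ v : V, G.Walk x v //
          p.2.IsPath ∧ p.2.length = n ∧ (G.dist x p.1 : ℝ) < ε * n} : ℝ)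
        ≤ Real.exp (-c * n) * cn x n := by
  have hne : Nonempty V := hconn.nonempty
  have hf_nonneg : ∀ n : ℕ, 0 ≤ (⨅ x : V, (cn x n : ℝ)) ^ (1 / (n : ℝ)) := fun n =>
    Real.rpow_nonneg (Real.iInf_nonneg fun x => Nat.cast_nonneg _) _
  have hg_nonneg : ∀ n : ℕ, 0 ≤ (⨆ x : V, (pn x n : ℝ)) ^ (1 / (n : ℝ)) := fun n =>
    Real.rpow_nonneg (Real.iSup_nonneg fun x => Nat.cast_nonneg _) _
  have hL : 0 ≤ limsup (fun n : ℕ => (⨆ x : V, (pn x n : ℝ)) ^ (1 / (n : ℝ))) atTop := by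
    rw [limsup_eq]
    refine Real.sInf_nonneg fun a ha => ?_
    obtain ⟨n, hn⟩ := Eventually.exists ha
    exact (hg_nonneg n).trans hn
  obtain ⟨μ, hμl, hμr⟩ := exists_between hlim
  obtain ⟨ρ, hρl, hρμ⟩ := exists_between hμl
  obtain ⟨τ, hμτ, hτr⟩ := exists_between hμr
  obtain ⟨ν, hμν, hντ⟩ := exists_between hμτ
  have hρ : 0 < ρ := hL.trans_lt hρl
  have hμ : 0 < μ := hρ.trans hρμ
  have hν : 0 < ν := hμ.trans hμν
  have hτ : 0 < τ := hν.trans hντ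
  have hcn : ∀ᶠ n : ℕ in atTop, ∀ x, τ ^ n ≤ (cn x n : ℝ) := by
    filter_upwards [eventually_lt_of_lt_liminf hτr (isBoundedUnder_of ⟨0, hf_nonneg⟩),
      eventually_ge_atTop 1] with n hn hn1 x
    have h0 : (0 : ℝ) ≤ ⨅ x : V, (cn x n : ℝ) := Real.iInf_nonneg fun x => Nat.cast_nonneg _
    calc τ ^ n ≤ ((⨅ x : V, (cn x n : ℝ)) ^ (1 / (n : ℝ))) ^ n := by gcongr
      _ = ⨅ x : V, (cn x n : ℝ) := by
        rw [one_div, Real.rpow_inv_natCast_pow h0 (by omega)]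
      _ ≤ cn x n := ciInf_le ⟨0, by rintro _ ⟨y, rfl⟩; exact Nat.cast_nonneg _⟩ x
  obtain ⟨N₁, hN₁⟩ := eventually_atTop.1 hcn
  have hfin : ∀ v, (G.neighborSet v).Finite :=
    SimpleGraph.finite_neighborSet_of_card_pos (N := N₁) fun n hn x => by
      rw [← hc]
      exact_mod_cast (pow_pos hτ n).trans_le (hN₁ n hn x)
  have hwalk := G.finite_setOf_walk_length_eq hfin hdeg
  have hf : ∀ a b k, (G.pathsOfLength a b k).Finite := fun a b k =>
    (hwalk a b k).1.subset fun w hw => hw.2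
  have hpn : ∀ x n, (pn x n : ℝ) ≤ (D : ℝ) ^ n := fun x n => by
    rw [hp]
    exact_mod_cast (Set.ncard_le_ncard (fun w hw => hw.2 :
      {w : G.Walk x x | w.IsCycle ∧ w.length = n} ⊆ {w | w.length = n}) (hwalk x x n).1).trans (hwalk x x n).2
  have hpn' : ∀ᶠ n : ℕ in atTop, ∀ x, (pn x n : ℝ) ≤ ρ ^ n := by
    have hbdd : IsBoundedUnder (· ≤ ·) atTop
        (fun n : ℕ => (⨆ x : V, (pn x n : ℝ)) ^ (1 / (n : ℝ))) := by
      refine isBoundedUnder_of_eventually_le (a := (D : ℝ)) ?_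
      filter_upwards [eventually_ge_atTop 1] with n hn
      calc _ ≤ ((D : ℝ) ^ n) ^ (1 / (n : ℝ)) :=
            Real.rpow_le_rpow (Real.iSup_nonneg fun x => Nat.cast_nonneg _)
              (ciSup_le fun x => hpn x n) (by positivity)
        _ = D := by rw [one_div, Real.pow_rpow_inv_natCast (Nat.cast_nonneg _) (by omega)]
    filter_upwards [eventually_lt_of_limsup_lt hρl hbdd, eventually_ge_atTop 1] with n hn hn1 x
    calc (pn x n : ℝ) ≤ ⨆ x : V, (pn x n : ℝ) :=
          le_ciSup (f := fun x => (pn x n : ℝ))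
            ⟨(D : ℝ) ^ n, by rintro _ ⟨y, rfl⟩; exact hpn y n⟩ x
      _ = ((⨆ x : V, (pn x n : ℝ)) ^ (1 / (n : ℝ))) ^ n := by
          rw [one_div, Real.rpow_inv_natCast_pow
            (Real.iSup_nonneg fun x => Nat.cast_nonneg _) (by omega)]
      _ ≤ ρ ^ n := pow_le_pow_left₀ (hg_nonneg n) hn.le n
  obtain ⟨N₂, hN₂⟩ := eventually_atTop.1 hpn'
  set M : ℝ := max 1 (D / ρ)
  set C : ℝ := ρ + M ^ (N₂ + 2)
  have hM1 : 1 ≤ M := le_max_left _ _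
  have hC : 0 ≤ C := by positivity
  have hadj : ∀ x z k, G.Adj x z → ((G.pathsOfLength x z k).ncard : ℝ) ≤ C * ρ ^ k := by
    intro x z k h
    rcases le_or_gt (N₂ + 2) k with hk | hk
    · have h1 := SimpleGraph.ncard_pathsOfLength_le_ncard_isCycle h (by omega : 2 ≤ k)
        (hwalk z z (k + 1)).1
      have h2 : (({w : G.Walk z z | w.IsCycle ∧ w.length = k + 1}.ncard : ℕ) : ℝ)
          ≤ ρ ^ (k + 1) := by
        have := hN₂ (k + 1) (by omega) z
        rwa [hp] at this
      calc _ ≤ ρ ^ (k + 1) := (Nat.cast_le.2 h1).trans h2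
        _ = ρ * ρ ^ k := pow_succ' _ _
        _ ≤ C * ρ ^ k := by
          gcongr
          exact le_add_of_nonneg_right (by positivity)
    · have h1 := (Set.ncard_le_ncard (fun w hw => hw.2 :
        G.pathsOfLength x z k ⊆ {w | w.length = k}) (hwalk x z k).1).trans (hwalk x z k).2
      calc ((G.pathsOfLength x z k).ncard : ℝ) ≤ (D : ℝ) ^ k := by exact_mod_cast h1
        _ = (D / ρ) ^ k * ρ ^ k := by rw [div_pow, div_mul_cancel₀ _ (by positivity)]
        _ ≤ M ^ k * ρ ^ k := by
          gcongr
          exact le_max_right _ _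
        _ ≤ C * ρ ^ k := by
          gcongr
          exact (pow_le_pow_right₀ hM1 hk.le).trans (le_add_of_nonneg_left hρ.le)
  set A : ℝ := μ + C / (1 - ρ / μ)
  have hA : 0 ≤ A := by
    have : 0 < 1 - ρ / μ := sub_pos.2 ((div_lt_one hμ).2 hρμ)
    positivity
  set K : ℝ := max 1 (D * A)
  have hK1 : 1 ≤ K := le_max_left _ _
  have hball : ∀ x n (r : ℕ),
      ({p : Σ v, G.Walk x v | p.2.IsPath ∧ p.2.length = n ∧ G.dist x p.1 ≤ r}.ncard : ℝ)
        ≤ (2 * K) ^ r * μ ^ n := by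
    intro x n r
    calc _ ≤ ∑ d ∈ Finset.range (r + 1), (D * A) ^ d * μ ^ n :=
          SimpleGraph.ncard_setOf_dist_le hconn hfin hdeg hA (by positivity) hf
            (fun y v => SimpleGraph.ncard_pathsOfLength_le_pow hρ hρμ hC hf hadj v n) r
      _ ≤ ∑ d ∈ Finset.range (r + 1), K ^ r * μ ^ n := by
          refine Finset.sum_le_sum fun d hd => ?_
          gcongr
          exact (pow_le_pow_left₀ (by positivity) (le_max_right _ _) d).trans
            (pow_le_pow_right₀ hK1 (Nat.lt_succ_iff.1 (Finset.mem_range.1 hd)))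
      _ = (r + 1 : ℕ) * (K ^ r * μ ^ n) := by simp
      _ ≤ 2 ^ r * (K ^ r * μ ^ n) := by
          gcongr
          exact_mod_cast Nat.lt_two_pow_self (n := r)
      _ = _ := by rw [mul_pow]; ring
  have hlogK : 0 < Real.log (2 * K) := Real.log_pos (by linarith)
  have hlogν : 0 < Real.log (ν / μ) := Real.log_pos ((one_lt_div hμ).2 hμν)
  set ε₀ : ℝ := Real.log (ν / μ) / Real.log (2 * K) with hε₀
  have hε₀pos : 0 < ε₀ := div_pos hlogν hlogK
  have hpow : ∀ n : ℕ, (2 * K) ^ ⌊ε₀ * n⌋₊ * μ ^ n ≤ ν ^ n := by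
    intro n
    have h2K : 0 < 2 * K := by linarith
    have hfloor : ((⌊ε₀ * n⌋₊ : ℕ) : ℝ) ≤ ε₀ * n := Nat.floor_le (by positivity)
    calc (2 * K) ^ ⌊ε₀ * n⌋₊ * μ ^ n ≤ (2 * K) ^ (ε₀ * n) * μ ^ n := by
          gcongr
          rw [← Real.rpow_natCast]
          exact Real.rpow_le_rpow_of_exponent_le (by linarith) hfloor
      _ = (ν / μ) ^ n * μ ^ n := by
          rw [Real.rpow_def_of_pos h2K, ← mul_assoc, hε₀, mul_div_cancel₀ _ hlogK.ne',
            mul_comm (Real.log _), Real.exp_nat_mul, Real.exp_log (by positivity)]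
      _ = ν ^ n := by rw [div_pow, div_mul_cancel₀ _ (by positivity)]
  refine ⟨min ε₀ (1 / (N₁ + 1)), lt_min hε₀pos (by positivity), Real.log (τ / ν),
    Real.log_pos ((one_lt_div hν).2 hντ), fun x n hn => ?_⟩
  have hn0 : (0 : ℝ) < n := by exact_mod_cast hn
  rcases lt_or_ge n N₁ with hnN | hnN
  · have hempty : IsEmpty {p : Σ v : V, G.Walk x v // p.2.IsPath ∧ p.2.length = n ∧
        (G.dist x p.1 : ℝ) < min ε₀ (1 / (N₁ + 1)) * n} := by
      refine ⟨?_⟩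
      rintro ⟨⟨y, w⟩, hw, hl, hd⟩
      have hlt : (G.dist x y : ℝ) < 1 := by
        refine hd.trans_le ?_
        calc min ε₀ (1 / (N₁ + 1)) * n ≤ 1 / (N₁ + 1) * n := by
              gcongr
              exact min_le_right _ _
          _ ≤ 1 := by
              rw [one_div_mul_eq_div, div_le_one (by positivity)]
              exact_mod_cast hnN.le.trans (Nat.le_succ _)
      have hxy : x = y := hconn.dist_eq_zero_iff.1 (Nat.lt_one_iff.1 (by exact_mod_cast hlt))
      subst hxy
      have hnil : w = SimpleGraph.Walk.nil := (SimpleGraph.Walk.isPath_iff_nil.1 hw).eq_nil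
      subst hnil
      have hzero : 0 = n := hl
      omega
    rw [Nat.card_of_isEmpty]
    simp only [Nat.cast_zero]
    positivity
  · have hsub : {p : Σ v : V, G.Walk x v | p.2.IsPath ∧ p.2.length = n ∧
        (G.dist x p.1 : ℝ) < min ε₀ (1 / (N₁ + 1)) * n} ⊆
        {p : Σ v, G.Walk x v | p.2.IsPath ∧ p.2.length = n ∧ G.dist x p.1 ≤ ⌊ε₀ * n⌋₊} := by
      rintro p ⟨hw, hl, hd⟩
      refine ⟨hw, hl, Nat.le_floor (hd.le.trans ?_)⟩
      gcongr
      exact min_le_left _ _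
    have hfinset : {p : Σ v, G.Walk x v |
        p.2.IsPath ∧ p.2.length = n ∧ G.dist x p.1 ≤ ⌊ε₀ * n⌋₊}.Finite := by
      obtain ⟨s, hs, -⟩ := SimpleGraph.exists_finset_walks_length_eq hfin hdeg n x
      exact s.finite_toSet.subset fun p hp => (hs p).2 hp.2.1
    calc _ ≤ (2 * K) ^ ⌊ε₀ * n⌋₊ * μ ^ n :=
          (Nat.cast_le.2 (Set.ncard_le_ncard hsub hfinset)).trans (hball x n _)
      _ ≤ ν ^ n := hpow n
      _ = Real.exp (-Real.log (τ / ν) * n) * τ ^ n := by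
          rw [← Real.log_inv, mul_comm (Real.log _), Real.exp_nat_mul,
            Real.exp_log (by positivity), inv_div, div_pow, div_mul_cancel₀ _ (by positivity)]
      _ ≤ Real.exp (-Real.log (τ / ν) * n) * cn x n := by
          gcongr
          exact hN₁ n hnN x
end

section
/- Let (a_n), (b_n), (c_n), (d_n), (e_n), (f_n), (g_n), (h_n) be the integer sequences with initial values (a_1,…,h_1) = (2,1,2,2,1,2,2,2) and, for n ≥ 2, a_n = c_{n−1} + f_{n−1}, b_n = c_{n−1}, c_n = a_{n−1} + d_{n−1}, d_n = a_{n−1} + e_{n−1}, e_n = f_{n−1}, f_n = a_{n−1} + g_{n−1}, g_n = a_{n−1} + h_{n−1}, h_n = a_{n−1} + b_{n−1}. Then the sequence a_n^{1/n} converges to a real number λ which is an eigenvalue of the 8×8 zero-one matrix of this linear recurrence, and λ > 1.9. -/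
open Filter

/-- A sequence squeezed between two positive multiples of `r ^ n` has `n`-th roots tending to `r`. -/
theorem tendsto_rpow_one_div_of_le_of_le {u : ℕ → ℝ} {r C D : ℝ} (hr : 0 < r) (hC : 0 < C)
    (hD : 0 < D) (hl : ∀ᶠ n in atTop, C * r ^ n ≤ u n) (hu : ∀ᶠ n in atTop, u n ≤ D * r ^ n) :
    Tendsto (fun n : ℕ => u n ^ (1 / (n : ℝ))) atTop (nhds r) := by
  have key : ∀ K : ℝ, 0 < K →
      Tendsto (fun n : ℕ => (K * r ^ n) ^ (1 / (n : ℝ))) atTop (nhds r) := by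
    intro K hK
    have h1 : Tendsto (fun n : ℕ => K ^ (1 / (n : ℝ)) * r) atTop (nhds r) := by
      simpa using ((tendsto_const_nhds (x := K)).rpow
        (tendsto_one_div_atTop_nhds_zero_nat (𝕜 := ℝ)) (Or.inl hK.ne')).mul_const r
    refine h1.congr' ?_
    filter_upwards [eventually_ne_atTop 0] with n hn
    rw [Real.mul_rpow hK.le (by positivity), one_div, Real.pow_rpow_inv_natCast hr.le hn]
  refine tendsto_of_tendsto_of_tendsto_of_le_of_le' (key C hC) (key D hD) ?_ ?_
  · filter_upwards [hl] with n hn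
    exact Real.rpow_le_rpow (by positivity) hn (by positivity)
  · filter_upwards [hl, hu] with n hn hn'
    exact Real.rpow_le_rpow (le_trans (by positivity) hn) hn' (by positivity)

namespace Matrix

variable {ι : Type*} [Fintype ι]

theorem mulVec_mono_of_nonneg {M : Matrix ι ι ℝ} (hM : ∀ i j, 0 ≤ M i j) {v w : ι → ℝ}
    (h : v ≤ w) : M *ᵥ v ≤ M *ᵥ w := fun i =>
  Finset.sum_le_sum fun j _ => mul_le_mul_of_nonneg_left (h j) (hM i j)

theorem smul_le_of_mulVec_eq_smul {M : Matrix ι ι ℝ} (hM : ∀ i j, 0 ≤ M i j) {v : ι → ℝ}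
    {r K : ℝ} (hv : M *ᵥ v = r • v) {x : ℕ → ι → ℝ} (hx : ∀ n, x (n + 1) = M *ᵥ x n)
    (h0 : K • v ≤ x 0) (n : ℕ) : (K * r ^ n) • v ≤ x n := by
  induction n with
  | zero => simpa using h0
  | succ n ih =>
    rw [hx]
    refine le_of_eq_of_le ?_ (mulVec_mono_of_nonneg hM ih)
    rw [mulVec_smul, hv, smul_smul, pow_succ, mul_assoc]

theorem le_smul_of_mulVec_eq_smul {M : Matrix ι ι ℝ} (hM : ∀ i j, 0 ≤ M i j) {v : ι → ℝ}
    {r K : ℝ} (hv : M *ᵥ v = r • v) {x : ℕ → ι → ℝ} (hx : ∀ n, x (n + 1) = M *ᵥ x n)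
    (h0 : x 0 ≤ K • v) (n : ℕ) : x n ≤ (K * r ^ n) • v := by
  induction n with
  | zero => simpa using h0
  | succ n ih =>
    rw [hx]
    refine (mulVec_mono_of_nonneg hM ih).trans_eq ?_
    rw [mulVec_smul, hv, smul_smul, pow_succ, mul_assoc]

theorem isRoot_charpoly_of_mulVec_eq_smul [DecidableEq ι] {M : Matrix ι ι ℝ} {v : ι → ℝ} {r : ℝ}
    (hv0 : v ≠ 0) (hv : M *ᵥ v = r • v) : M.charpoly.IsRoot r := by
  rw [Polynomial.IsRoot, eval_charpoly]
  refine exists_mulVec_eq_zero_iff.mp ⟨v, hv0, ?_⟩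
  rw [sub_mulVec, hv, scalar_apply, ← smul_one_eq_diagonal, smul_mulVec, one_mulVec, sub_self]

end Matrix

theorem exists_root_between :
    ∃ r : ℝ, 1.9 < r ∧ r < 2 ∧
      r ^ 7 = 2 * r ^ 5 + 2 * r ^ 4 + r ^ 3 + r ^ 2 + 2 * r + 3 := by
  have hcont : ContinuousOn
      (fun r : ℝ => r ^ 7 - (2 * r ^ 5 + 2 * r ^ 4 + r ^ 3 + r ^ 2 + 2 * r + 3))
      (Set.Icc 1.9 2) := by fun_prop
  obtain ⟨r, ⟨h1, h2⟩, h⟩ := intermediate_value_Ioo (by norm_num) hcont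
    (show (0 : ℝ) ∈ Set.Ioo _ _ by constructor <;> norm_num)
  exact ⟨r, h1, h2, sub_eq_zero.mp h⟩

/-- A Perron eigenvector of the transfer matrix, for the eigenvalue `r`. -/
def perronVec (r : ℝ) : Fin 8 → ℝ :=
  ![r ^ 7 - 1, r ^ 5 + r ^ 4 + r ^ 2 + r + 1, r ^ 6 + r ^ 5 + r ^ 3 + r ^ 2 + r,
    r ^ 6 + r ^ 4 + r ^ 3 + r ^ 2 + 1, r ^ 5 + r ^ 4 + r ^ 3 + r + 1,
    r ^ 6 + r ^ 5 + r ^ 4 + r ^ 2 + r, r ^ 6 + r ^ 5 + r ^ 3 + r ^ 2 + 1,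
    r ^ 6 + r ^ 4 + r ^ 3 + r + 1]

theorem perronVec_mem_Icc {r : ℝ} (h1 : 1.9 < r) (h2 : r < 2) (i : Fin 8) :
    perronVec r i ∈ Set.Icc 1 128 := by
  have hl (n : ℕ) : (1.9 : ℝ) ^ n ≤ r ^ n := by gcongr
  have hu (n : ℕ) : r ^ n ≤ 2 ^ n := pow_le_pow_left₀ (by linarith) h2.le n
  have l2 := hl 2; have l3 := hl 3; have l4 := hl 4; have l5 := hl 5; have l6 := hl 6
  have l7 := hl 7
  have u2 := hu 2; have u3 := hu 3; have u4 := hu 4; have u5 := hu 5; have u6 := hu 6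
  have u7 := hu 7
  norm_num at l2 l3 l4 l5 l6 l7 u2 u3 u4 u5 u6 u7
  fin_cases i <;> simp [perronVec] <;> constructor <;> linarith

/-- For the eight sequences arising from counting restricted SAWs on `H(3,7)`, the
sequence `a_n^{1/n}` converges to an eigenvalue `λ > 1.9` of the transfer matrix. -/
theorem h37_growth_rate
    (a b c d e f g h : ℕ → ℤ)
    (ha1 : a 1 = 2) (hb1 : b 1 = 1) (hc1 : c 1 = 2) (hd1 : d 1 = 2)
    (he1 : e 1 = 1) (hf1 : f 1 = 2) (hg1 : g 1 = 2) (hh1 : h 1 = 2)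
    (ha : ∀ n : ℕ, 2 ≤ n → a n = c (n - 1) + f (n - 1))
    (hb : ∀ n : ℕ, 2 ≤ n → b n = c (n - 1))
    (hc : ∀ n : ℕ, 2 ≤ n → c n = a (n - 1) + d (n - 1))
    (hd : ∀ n : ℕ, 2 ≤ n → d n = a (n - 1) + e (n - 1))
    (he : ∀ n : ℕ, 2 ≤ n → e n = f (n - 1))
    (hf : ∀ n : ℕ, 2 ≤ n → f n = a (n - 1) + g (n - 1))
    (hg : ∀ n : ℕ, 2 ≤ n → g n = a (n - 1) + h (n - 1))
    (hh : ∀ n : ℕ, 2 ≤ n → h n = a (n - 1) + b (n - 1)) :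
    ∃ lam : ℝ,
      Tendsto (fun n : ℕ => (a n : ℝ) ^ (1 / (n : ℝ))) atTop (nhds lam) ∧
      (Matrix.charpoly
        (!![0, 0, 1, 0, 0, 1, 0, 0;
            0, 0, 1, 0, 0, 0, 0, 0;
            1, 0, 0, 1, 0, 0, 0, 0;
            1, 0, 0, 0, 1, 0, 0, 0;
            0, 0, 0, 0, 0, 1, 0, 0;
            1, 0, 0, 0, 0, 0, 1, 0;
            1, 0, 0, 0, 0, 0, 0, 1;
            1, 1, 0, 0, 0, 0, 0, 0] : Matrix (Fin 8) (Fin 8) ℝ)).IsRoot lam ∧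
      1.9 < lam := by
  obtain ⟨r, h1, h2, hr⟩ := exists_root_between
  set M : Matrix (Fin 8) (Fin 8) ℝ :=
    !![0, 0, 1, 0, 0, 1, 0, 0;
       0, 0, 1, 0, 0, 0, 0, 0;
       1, 0, 0, 1, 0, 0, 0, 0;
       1, 0, 0, 0, 1, 0, 0, 0;
       0, 0, 0, 0, 0, 1, 0, 0;
       1, 0, 0, 0, 0, 0, 1, 0;
       1, 0, 0, 0, 0, 0, 0, 1;
       1, 1, 0, 0, 0, 0, 0, 0] with hMdef
  have hr0 : 0 < r := by linarith
  have hM : ∀ i j, 0 ≤ M i j := by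
    intro i j
    fin_cases i <;> fin_cases j <;> simp [hMdef]
  have hv : M.mulVec (perronVec r) = r • perronVec r := by
    ext i
    fin_cases i <;> simp [hMdef, perronVec, Matrix.mulVec, dotProduct, Fin.sum_univ_succ] <;>
      grind
  have hv0 : perronVec r ≠ 0 := by
    intro hz
    have := (perronVec_mem_Icc h1 h2 0).1
    norm_num [hz] at this
  let x : ℕ → Fin 8 → ℝ := fun n =>
    ![a (n + 1), b (n + 1), c (n + 1), d (n + 1), e (n + 1), f (n + 1), g (n + 1), h (n + 1)]
  have hx : ∀ n, x (n + 1) = M.mulVec (x n) := by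
    intro n
    have hn : 2 ≤ n + 1 + 1 := by omega
    ext i
    fin_cases i <;>
      simp [hMdef, x, Matrix.mulVec, dotProduct, Fin.sum_univ_succ, ha _ hn, hb _ hn, hc _ hn,
        hd _ hn, he _ hn, hf _ hn, hg _ hn, hh _ hn]
  have hx0 : ∀ i, x 0 i ∈ Set.Icc 1 2 := by
    intro i
    fin_cases i <;> simp [x, ha1, hb1, hc1, hd1, he1, hf1, hg1, hh1]
  have hlow := Matrix.smul_le_of_mulVec_eq_smul hM hv hx (K := 1 / 128) fun i => by
    have := (perronVec_mem_Icc h1 h2 i).2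
    have := (hx0 i).1
    simp only [Pi.smul_apply, smul_eq_mul]
    linarith
  have hup := Matrix.le_smul_of_mulVec_eq_smul hM hv hx (K := 2) fun i => by
    have := (perronVec_mem_Icc h1 h2 i).1
    have := (hx0 i).2
    simp only [Pi.smul_apply, smul_eq_mul]
    linarith
  have hv1 := (perronVec_mem_Icc h1 h2 0).1
  have hp : 0 < perronVec r 0 := by linarith
  refine ⟨r, tendsto_rpow_one_div_of_le_of_le hr0 (C := 1 / 128 * perronVec r 0 / r)
    (D := 2 * perronVec r 0 / r) (by positivity) (by positivity) ?_ ?_,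
    Matrix.isRoot_charpoly_of_mulVec_eq_smul hv0 hv, h1⟩
  · filter_upwards [eventually_ge_atTop 1] with n hn
    obtain ⟨m, rfl⟩ := Nat.exists_eq_add_of_le' hn
    refine le_of_eq_of_le ?_ (hlow m 0)
    simp only [Pi.smul_apply, smul_eq_mul]
    rw [pow_succ]
    field_simp
  · filter_upwards [eventually_ge_atTop 1] with n hn
    obtain ⟨m, rfl⟩ := Nat.exists_eq_add_of_le' hn
    refine (hup m 0).trans_eq ?_
    simp only [Pi.smul_apply, smul_eq_mul]
    rw [pow_succ]
    field_simp
end
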